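/- Let k be a field of characteristic different from 2, let D (with embedding φ : kΓ → D) be a division ring of quotients of the group algebra kΓ of the Heisenberg group Γ, and let * be a k-involution on D induced by an involution ⋆ on Γ. If there do not exist integers m, n such that x⋆ = λ^m·x and y⋆ = λ^n·y, then the multiplicative group D^× contains a free unitary pair. -/

import Mathlib

/-- The commutator `g⁻¹h⁻¹gh` used in the paper's convention. -/
def commS {G : Type*} [Group G] (g h : G) : G := g⁻¹ * h⁻¹ * g * h

/-- Relations of the Heisenberg group: `[[x,y],x] = [[x,y],y] = 1`. -/
def heisRels : Set (FreeGroup (Fin 2)) :=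
  { commS (commS (FreeGroup.of 0) (FreeGroup.of 1)) (FreeGroup.of 0),
    commS (commS (FreeGroup.of 0) (FreeGroup.of 1)) (FreeGroup.of 1) }

/-- The Heisenberg group, presented by `x, y` with `[[x,y],x] = [[x,y],y] = 1`. -/
abbrev Heisenberg : Type := PresentedGroup heisRels

/-- The generator `x` of the Heisenberg group. -/
def Hx : Heisenberg := PresentedGroup.of 0

/-- The generator `y` of the Heisenberg group. -/
def Hy : Heisenberg := PresentedGroup.of 1

/-- The central element `λ = [x,y]`. -/
def Hlam : Heisenberg := commS Hx Hy

/-- A pair of elements of a group is free if the induced map from the free group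
on two generators is injective. -/
def IsFreePair {G : Type*} [Group G] (u v : G) : Prop :=
  Function.Injective ⇑(FreeGroup.lift (fun b : Bool => if b then u else v) : FreeGroup Bool →* G)

section RankOne

open Matrix

variable {K F O : Type*} [Field K] [Field F] [CommRing O]

/-- If every letter of a free group acts, up to a scalar, by a matrix whose reduction is a
rank-one matrix, then the product over a reduced word has the same property. -/
theorem prod_reduced_rank_one (j : O →+* K) (ε : O →+* F)
    (M : Bool × Bool → Matrix (Fin 2) (Fin 2) K) (A : Bool × Bool → Matrix (Fin 2) (Fin 2) O)
    (κ : Bool × Bool → K) (c : Bool × Bool → F) (α : Bool × Bool → Fin 2 → F)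
    (hM : ∀ l, M l = κ l • (A l).map j)
    (hA : ∀ l, (A l).map ε = c l • vecMulVec (α l) (α l)) (hc : ∀ l, c l ≠ 0)
    (hα : ∀ l l' : Bool × Bool, (l.1 = l'.1 → l.2 = l'.2) → α l ⬝ᵥ α l' ≠ 0)
    (L : List (Bool × Bool)) (l : Bool × Bool) (hL : FreeGroup.IsReduced (l :: L)) :
    ∃ (B : Matrix (Fin 2) (Fin 2) O) (t : K) (d : F) (l' : Bool × Bool), d ≠ 0 ∧
      ((l :: L).map M).prod = t • B.map j ∧ B.map ε = d • vecMulVec (α l) (α l') := by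
  induction L generalizing l with
  | nil => exact ⟨A l, κ l, c l, l, hc l, by simpa using hM l, hA l⟩
  | cons m L ih =>
    rw [FreeGroup.isReduced_cons_cons] at hL
    obtain ⟨B, t, d, l', hd, h1, h2⟩ := ih m hL.2
    refine ⟨A l * B, κ l * t, c l * d * (α l ⬝ᵥ α m), l',
      mul_ne_zero (mul_ne_zero (hc l) hd) (hα l m hL.1), ?_, ?_⟩
    · rw [List.map_cons, List.prod_cons, h1, hM l, Matrix.map_mul, smul_mul_smul_comm]
    · rw [Matrix.map_mul, hA l, h2, smul_mul_smul_comm, vecMulVec_mul_vecMulVec, vecMulVec_smul,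
        smul_smul]

/-- Freeness criterion for two invertible matrices, by reduction to rank-one matrices. -/
theorem lift_injective_of_rank_one {j : O →+* K} (hj : Function.Injective j) (ε : O →+* F)
    (U : Bool → (Matrix (Fin 2) (Fin 2) K)ˣ) (A : Bool × Bool → Matrix (Fin 2) (Fin 2) O)
    (κ : Bool × Bool → K) (c : Bool × Bool → F) (α : Bool × Bool → Fin 2 → F)
    (hU : ∀ l : Bool × Bool, ((bif l.2 then U l.1 else (U l.1)⁻¹ :
      (Matrix (Fin 2) (Fin 2) K)ˣ) : Matrix (Fin 2) (Fin 2) K) = κ l • (A l).map j)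
    (hA : ∀ l, (A l).map ε = c l • vecMulVec (α l) (α l)) (hc : ∀ l, c l ≠ 0)
    (hα : ∀ l l' : Bool × Bool, (l.1 = l'.1 → l.2 = l'.2) → α l ⬝ᵥ α l' ≠ 0)
    (hα' : ∀ l, α l ≠ 0) :
    Function.Injective (FreeGroup.lift U) := by
  rw [injective_iff_map_eq_one]
  intro w hw
  by_contra hne
  have hred : FreeGroup.IsReduced w.toWord := FreeGroup.isReduced_toWord
  have hnil : w.toWord ≠ [] := by rwa [Ne, FreeGroup.toWord_eq_nil_iff]
  rw [← FreeGroup.mk_toWord (x := w), FreeGroup.lift_mk] at hw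
  obtain ⟨l, L, hl⟩ := List.exists_cons_of_ne_nil hnil
  rw [hl] at hred hw
  obtain ⟨B, t, d, l', hd, h1, h2⟩ := prod_reduced_rank_one j ε
    (fun l => ((bif l.2 then U l.1 else (U l.1)⁻¹ : (Matrix (Fin 2) (Fin 2) K)ˣ) :
      Matrix (Fin 2) (Fin 2) K)) A κ c α hU hA hc hα L l hred
  have h3 : t • B.map j = 1 := by
    rw [← h1, ← Units.val_one, ← hw, ← Units.coeHom_apply, map_list_prod, List.map_map]
    rfl
  have e00 : t * j (B 0 0) = 1 := by simpa using congrFun (congrFun h3 0) 0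
  have e11 : t * j (B 1 1) = 1 := by simpa using congrFun (congrFun h3 1) 1
  have e01 : t * j (B 0 1) = 0 := by simpa using congrFun (congrFun h3 0) 1
  have e10 : t * j (B 1 0) = 0 := by simpa using congrFun (congrFun h3 1) 0
  have ht : t ≠ 0 := left_ne_zero_of_mul_eq_one e00
  have b01 : B 0 1 = 0 := hj (by simpa [ht] using e01)
  have b10 : B 1 0 = 0 := hj (by simpa [ht] using e10)
  have b11 : B 0 0 = B 1 1 := hj (mul_left_cancel₀ ht (e00.trans e11.symm))
  have f (i k : Fin 2) : ε (B i k) = d * (α l i * α l' k) := by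
    simpa [vecMulVec_apply] using congrFun (congrFun h2 i) k
  have f01 : α l 0 * α l' 1 = 0 := by simpa [b01, hd] using (f 0 1).symm
  have f10 : α l 1 * α l' 0 = 0 := by simpa [b10, hd] using (f 1 0).symm
  have f11 : α l 0 * α l' 0 = α l 1 * α l' 1 :=
    mul_left_cancel₀ hd (by rw [← f, ← f, b11])
  have hz : α l 0 * α l' 0 = 0 := by
    have : (α l 0 * α l' 0) * (α l 0 * α l' 0) = 0 := by
      nth_rewrite 2 [f11]
      linear_combination α l' 0 * α l 1 * f01
    exact mul_self_eq_zero.1 this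
  rw [hz] at f11
  have key : (α l 0 = 0 ∧ α l 1 = 0) ∨ (α l' 0 = 0 ∧ α l' 1 = 0) := by
    have f11' := f11.symm
    rw [mul_eq_zero] at hz f11' f01 f10
    tauto
  rcases key with ⟨h, h'⟩ | ⟨h, h'⟩
  · exact hα' l (by ext i; fin_cases i <;> simp [h, h'])
  · exact hα' l' (by ext i; fin_cases i <;> simp [h, h'])

end RankOne

/-- Freeness of a pair of units can be checked in an image ring, and is preserved by injective
ring homomorphisms. -/
theorem isFreePair_map_of_lift_injective {R T D : Type*} [Ring R] [Ring T] [Ring D]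
    (ρ : R →+* T) {j : R →+* D} (hj : Function.Injective j) (u v : Rˣ)
    (h : Function.Injective (FreeGroup.lift (fun b : Bool =>
      Units.map (ρ : R →* T) (if b then u else v)))) :
    IsFreePair (Units.map (j : R →* D) u) (Units.map (j : R →* D) v) := by
  have h1 : FreeGroup.lift (fun b : Bool => Units.map (ρ : R →* T) (if b then u else v)) =
      (Units.map (ρ : R →* T)).comp (FreeGroup.lift (fun b : Bool => if b then u else v)) := by
    ext b
    simp
  have h2 : FreeGroup.lift (fun b : Bool => if b then Units.map (j : R →* D) u
        else Units.map (j : R →* D) v) =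
      (Units.map (j : R →* D)).comp (FreeGroup.lift (fun b : Bool => if b then u else v)) := by
    ext b
    cases b <;> simp
  rw [h1] at h
  rw [IsFreePair, h2]
  rw [MonoidHom.coe_comp] at h ⊢
  exact (Units.map_injective hj).comp h.of_comp

/-- Coordinates on the Heisenberg group: `(a, b, c)` stands for `x ^ a * y ^ b * λ ^ c`. -/
@[ext]
structure HeisCoord where
  /-- exponent of `x` -/
  a : ℤ
  /-- exponent of `y` -/
  b : ℤ
  /-- exponent of the commutator -/
  c : ℤ

namespace HeisCoord

instance : Mul HeisCoord := ⟨fun g h => ⟨g.a + h.a, g.b + h.b, g.c + h.c - h.a * g.b⟩⟩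
instance : One HeisCoord := ⟨⟨0, 0, 0⟩⟩
instance : Inv HeisCoord := ⟨fun g => ⟨-g.a, -g.b, -g.c - g.a * g.b⟩⟩

@[simp] theorem mul_a (g h : HeisCoord) : (g * h).a = g.a + h.a := rfl
@[simp] theorem mul_b (g h : HeisCoord) : (g * h).b = g.b + h.b := rfl
@[simp] theorem mul_c (g h : HeisCoord) : (g * h).c = g.c + h.c - h.a * g.b := rfl
@[simp] theorem one_a : (1 : HeisCoord).a = 0 := rfl
@[simp] theorem one_b : (1 : HeisCoord).b = 0 := rfl
@[simp] theorem one_c : (1 : HeisCoord).c = 0 := rfl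
@[simp] theorem inv_a (g : HeisCoord) : (g⁻¹).a = -g.a := rfl
@[simp] theorem inv_b (g : HeisCoord) : (g⁻¹).b = -g.b := rfl
@[simp] theorem inv_c (g : HeisCoord) : (g⁻¹).c = -g.c - g.a * g.b := rfl

instance : Group HeisCoord :=
  Group.ofLeftAxioms (fun g h l => by ext <;> simp <;> ring) (fun g => by ext <;> simp)
    (fun g => by ext <;> simp; ring)

/-- The first coordinate as a homomorphism. -/
def homA : HeisCoord →* Multiplicative ℤ where
  toFun g := Multiplicative.ofAdd g.a
  map_one' := rfl
  map_mul' _ _ := rfl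

/-- The second coordinate as a homomorphism. -/
def homB : HeisCoord →* Multiplicative ℤ where
  toFun g := Multiplicative.ofAdd g.b
  map_one' := rfl
  map_mul' _ _ := rfl

@[simp] theorem zpow_a (g : HeisCoord) (n : ℤ) : (g ^ n).a = n * g.a := by
  simpa [homA] using congrArg Multiplicative.toAdd (map_zpow homA g n)

@[simp] theorem zpow_b (g : HeisCoord) (n : ℤ) : (g ^ n).b = n * g.b := by
  simpa [homB] using congrArg Multiplicative.toAdd (map_zpow homB g n)

/-- Central elements multiply additively in the last coordinate. -/
def homC : Multiplicative ℤ →* HeisCoord where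
  toFun n := ⟨0, 0, n.toAdd⟩
  map_one' := rfl
  map_mul' m n := by ext <;> simp

theorem central_zpow (d n : ℤ) : (⟨0, 0, d⟩ : HeisCoord) ^ n = ⟨0, 0, n * d⟩ := by
  have := map_zpow homC (Multiplicative.ofAdd d) n
  simpa [homC] using this.symm

/-- The generator with coordinates `(1, 0, 0)`. -/
def x : HeisCoord := ⟨1, 0, 0⟩
/-- The generator with coordinates `(0, 1, 0)`. -/
def y : HeisCoord := ⟨0, 1, 0⟩
/-- The central element with coordinates `(0, 0, 1)`. -/
def z : HeisCoord := ⟨0, 0, 1⟩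

@[simp] theorem x_a : x.a = 1 := rfl
@[simp] theorem x_b : x.b = 0 := rfl
@[simp] theorem x_c : x.c = 0 := rfl
@[simp] theorem y_a : y.a = 0 := rfl
@[simp] theorem y_b : y.b = 1 := rfl
@[simp] theorem y_c : y.c = 0 := rfl
@[simp] theorem z_a : z.a = 0 := rfl
@[simp] theorem z_b : z.b = 0 := rfl
@[simp] theorem z_c : z.c = 1 := rfl

@[simp] theorem z_zpow (n : ℤ) : z ^ n = ⟨0, 0, n⟩ := by
  simpa [z] using central_zpow 1 n

theorem x_zpow (n : ℤ) : x ^ n = ⟨n, 0, 0⟩ := by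
  let f : Multiplicative ℤ →* HeisCoord :=
    { toFun := fun n => ⟨n.toAdd, 0, 0⟩, map_one' := rfl, map_mul' := fun m n => by ext <;> simp }
  simpa [f, x] using (map_zpow f (Multiplicative.ofAdd 1) n).symm

theorem y_zpow (n : ℤ) : y ^ n = ⟨0, n, 0⟩ := by
  let f : Multiplicative ℤ →* HeisCoord :=
    { toFun := fun n => ⟨0, n.toAdd, 0⟩, map_one' := rfl, map_mul' := fun m n => by ext <;> simp }
  simpa [f, y] using (map_zpow f (Multiplicative.ofAdd 1) n).symm

theorem eq_prod (g : HeisCoord) : g = x ^ g.a * y ^ g.b * z ^ g.c := by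
  rw [x_zpow, y_zpow, z_zpow]
  ext <;> simp

theorem commS_eq (g h : HeisCoord) : commS g h = ⟨0, 0, g.a * h.b - h.a * g.b⟩ := by
  ext
  all_goals simp [commS]
  ring

theorem commute_of_central (g : HeisCoord) (n : ℤ) : Commute ⟨0, 0, n⟩ g := by
  rw [Commute, SemiconjBy]
  ext
  all_goals simp [add_comm]

theorem hom_ext {G : Type*} [Group G] {f f' : HeisCoord →* G} (hx : f x = f' x) (hy : f y = f' y) :
    f = f' := by
  have hz : f z = f' z := by
    have : z = commS x y := by rw [commS_eq]; ext <;> simp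
    rw [this]
    simp [commS, hx, hy]
  ext g
  rw [eq_prod g]
  simp only [map_mul, map_zpow, hx, hy, hz]

/-- Two elements commuting with their commutator define a homomorphism out of the
Heisenberg group. -/
def lift {G : Type*} [Group G] (g h μ : G) (hμ : commS g h = μ) (hg : Commute μ g)
    (hh : Commute μ h) : HeisCoord →* G :=
  MonoidHom.mk' (fun p => g ^ p.a * h ^ p.b * μ ^ p.c) (by
    have key (i j : ℤ) : h ^ j * g ^ i = g ^ i * h ^ j * μ ^ (-(i * j)) := by
      have h1 : SemiconjBy h (g * μ) g := by
        rw [SemiconjBy, ← hμ, commS]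
        group
      have h2 : h * (g ^ i * μ ^ i) = g ^ i * h := by
        have := (h1.zpow_right i).eq
        rwa [hg.symm.mul_zpow] at this
      have h3 : SemiconjBy (g ^ i) (h * μ ^ (-i)) h := by
        calc g ^ i * (h * μ ^ (-i)) = (g ^ i * h) * μ ^ (-i) := (mul_assoc _ _ _).symm
          _ = h * (g ^ i * μ ^ i) * μ ^ (-i) := by rw [h2]
          _ = h * g ^ i := by group
      have h4 := (h3.zpow_right j).eq
      rw [(hh.symm.zpow_right (-i)).mul_zpow, ← zpow_mul] at h4
      rw [← h4, mul_assoc, neg_mul]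
    intro p q
    have c1 := ((hg.zpow_zpow p.c q.a).mul_right (hh.zpow_zpow p.c q.b)).eq
    have c2 := (hh.zpow_zpow (-(q.a * p.b)) q.b).eq
    calc g ^ (p.a + q.a) * h ^ (p.b + q.b) * μ ^ (p.c + q.c - q.a * p.b)
        = g ^ p.a * (g ^ q.a * h ^ p.b * (h ^ q.b * μ ^ (-(q.a * p.b)))) * μ ^ p.c * μ ^ q.c := by
          group
      _ = g ^ p.a * (g ^ q.a * h ^ p.b * μ ^ (-(q.a * p.b))) * h ^ q.b * μ ^ p.c * μ ^ q.c := by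
          rw [← c2]; group
      _ = g ^ p.a * h ^ p.b * (g ^ q.a * h ^ q.b * μ ^ p.c) * μ ^ q.c := by
          rw [← key]; group
      _ = g ^ p.a * h ^ p.b * μ ^ p.c * (g ^ q.a * h ^ q.b * μ ^ q.c) := by
          rw [← c1]; group)

end HeisCoord

namespace HeisCoord

open Matrix

variable (k : Type*) [Field k]

/-- The field of Hahn series used as coefficients of the two-dimensional representation. -/
abbrev CoeffField : Type _ := HahnSeries (ℤ ×ₗ ℤ) k

/-- The monomial with exponent `(i, j)` and coefficient `r`. -/
noncomputable def mon {k : Type*} [Field k] (i j : ℤ) (r : k) : CoeffField k :=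
  HahnSeries.single (toLex (i, j)) r

theorem mon_mul (i j i' j' : ℤ) (r s : k) :
    mon i j r * mon i' j' s = mon (i + i') (j + j') (r * s) := by
  simp [mon, HahnSeries.single_mul_single, ← toLex_add]

/-- The constant matrix `σ_z ^ a * σ_x ^ b`. -/
def pauli (a b : ℤ) : Matrix (Fin 2) (Fin 2) k :=
  !![if Even b then 1 else 0, if Even b then 0 else 1;
    (-1) ^ a * if Even b then 0 else 1, (-1) ^ a * if Even b then 1 else 0]

theorem pauli_mul (a b a' b' : ℤ) :
    pauli k a b * pauli k a' b' = ((-1) ^ (a' * b) : k) • pauli k (a + a') (b + b') := by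
  have h : (-1 : k) ≠ 0 := by simp
  have h2 : ((-1 : k) ^ a') * (-1) ^ a' = 1 := by
    rw [← mul_zpow]; simp
  rcases Int.even_or_odd b with hb | hb <;> rcases Int.even_or_odd b' with hb' | hb'
  all_goals
    have e1 := hb
    have e2 := hb'
    try rw [← Int.not_even_iff_odd] at e1
    try rw [← Int.not_even_iff_odd] at e2
    ext i l
    fin_cases i <;> fin_cases l <;>
    simp [pauli, Int.even_add, e1, e2, zpow_add₀ h, mul_comm a' b, _root_.zpow_mul,
      hb.neg_one_zpow, h2, mul_left_comm]

/-- The multiplicative map underlying the representation sending the commutator to `-1`. -/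
noncomputable def repMonoidHom : HeisCoord →* Matrix (Fin 2) (Fin 2) (CoeffField k) where
  toFun g := of fun i l => mon g.a g.b ((-1) ^ g.c * pauli k g.a g.b i l)
  map_one' := by
    refine Matrix.ext fun i l => ?_
    fin_cases i <;> fin_cases l <;> simp [pauli, mon]
    all_goals rfl
  map_mul' g h := by
    refine Matrix.ext fun i l => ?_
    have h0 : (-1 : k) ≠ 0 := by simp
    have h2 : ((-1 : k) ^ (h.a * g.b)) * (-1) ^ (h.a * g.b) = 1 := by
      rw [← mul_zpow]; simp
    have h3 : ((-1 : k) ^ (-(h.a * g.b))) = (-1) ^ (h.a * g.b) := by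
      rw [_root_.zpow_neg]; exact inv_eq_of_mul_eq_one_left h2
    have h4 := congrFun (congrFun (pauli_mul k g.a g.b h.a h.b) i) l
    rw [Matrix.mul_apply, Fin.sum_univ_two, Matrix.smul_apply, smul_eq_mul] at h4
    rw [Matrix.mul_apply, Fin.sum_univ_two]
    simp only [of_apply, mon_mul, mul_a, mul_b, mul_c, sub_eq_add_neg, zpow_add₀ h0, h3]
    rw [mon, mon, mon, ← HahnSeries.single_add]
    congr 1
    linear_combination (-((-1 : k) ^ g.c * (-1) ^ h.c)) * h4

/-- The representation of the group algebra sending the commutator to `-1`. -/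
noncomputable def rep : MonoidAlgebra k HeisCoord →ₐ[k] Matrix (Fin 2) (Fin 2) (CoeffField k) :=
  MonoidAlgebra.lift k _ _ (repMonoidHom k)

theorem rep_of (g : HeisCoord) (i l : Fin 2) :
    rep k (MonoidAlgebra.of k _ g) i l = mon g.a g.b ((-1) ^ g.c * pauli k g.a g.b i l) := by
  rw [rep, MonoidAlgebra.lift_of]
  rfl

/-- The commutative shadow of the representation. -/
noncomputable def shadow : MonoidAlgebra k HeisCoord →ₗ[k] CoeffField k :=
  (Finsupp.lsum k fun g : HeisCoord =>
    LinearMap.toSpanSingleton k (CoeffField k) (mon g.a g.b ((-1) ^ g.c))) ∘ₗ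
    (MonoidAlgebra.coeffLinearEquiv k).toLinearMap

theorem shadow_of (g : HeisCoord) :
    shadow k (MonoidAlgebra.of k _ g) = mon g.a g.b ((-1) ^ g.c) := by
  simp [shadow]

theorem rep_coeff (f : MonoidAlgebra k HeisCoord) (i l : Fin 2) (n : ℤ ×ₗ ℤ) :
    (rep k f i l).coeff n = pauli k (ofLex n).1 (ofLex n).2 i l * (shadow k f).coeff n := by
  induction f using MonoidAlgebra.induction_on with
  | of g =>
    rw [rep_of, shadow_of, mon, mon, HahnSeries.coeff_single, HahnSeries.coeff_single]
    by_cases h : n = toLex (g.a, g.b)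
    · subst h
      simp [mul_comm]
    · simp [h]
  | add x y hx hy => simp [hx, hy, mul_add]
  | smul r x hx => simp [hx, mul_left_comm]

theorem shadow_eq_zero_of_det {f : MonoidAlgebra k HeisCoord} (h : (rep k f).det = 0) :
    shadow k f = 0 := by
  rw [det_fin_two, sub_eq_zero] at h
  have hs (n : ℤ) : (-1 : k) ^ n ≠ 0 := zpow_ne_zero _ (by simp)
  have hE (n : ℤ ×ₗ ℤ) : (rep k f 0 0).coeff n ≠ 0 ↔
      Even (ofLex n).2 ∧ (shadow k f).coeff n ≠ 0 := by
    rw [rep_coeff]; simp [pauli]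
  have hE' (n : ℤ ×ₗ ℤ) : (rep k f 1 1).coeff n ≠ 0 ↔
      Even (ofLex n).2 ∧ (shadow k f).coeff n ≠ 0 := by
    rw [rep_coeff]; simp [pauli, hs]
  have hO (n : ℤ ×ₗ ℤ) : (rep k f 0 1).coeff n ≠ 0 ↔
      ¬ Even (ofLex n).2 ∧ (shadow k f).coeff n ≠ 0 := by
    rw [rep_coeff]; simp [pauli]
  have hO' (n : ℤ ×ₗ ℤ) : (rep k f 1 0).coeff n ≠ 0 ↔
      ¬ Even (ofLex n).2 ∧ (shadow k f).coeff n ≠ 0 := by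
    rw [rep_coeff]; simp [pauli, hs]
  have horder {p q : CoeffField k} (hp : p ≠ 0) (hpq : ∀ n, p.coeff n ≠ 0 ↔ q.coeff n ≠ 0) :
      q ≠ 0 ∧ p.order = q.order := by
    have hq : q ≠ 0 := fun h0 => by
      have := (hpq _).1 (HahnSeries.coeff_order_eq_zero.not.2 hp)
      simp [h0] at this
    exact ⟨hq, le_antisymm
      (HahnSeries.order_le_of_coeff_ne_zero ((hpq _).2 (HahnSeries.coeff_order_eq_zero.not.2 hq)))
      (HahnSeries.order_le_of_coeff_ne_zero ((hpq _).1 (HahnSeries.coeff_order_eq_zero.not.2 hp)))⟩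
  by_cases he : rep k f 0 0 = 0
  · by_cases ho : rep k f 0 1 = 0
    · ext n
      by_contra hn
      by_cases hev : Even (ofLex n).2
      · exact (hE n).2 ⟨hev, hn⟩ (by simp [he])
      · exact (hO n).2 ⟨hev, hn⟩ (by simp [ho])
    · have ho' := horder ho (fun n => (hO n).trans (hO' n).symm)
      rw [he, zero_mul] at h
      exact absurd h.symm (mul_ne_zero ho ho'.1)
  · have he' := horder he (fun n => (hE n).trans (hE' n).symm)
    have ho : rep k f 0 1 ≠ 0 := fun h0 => by
      rw [h0, zero_mul] at h
      exact mul_ne_zero he he'.1 h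
    have ho' := horder ho (fun n => (hO n).trans (hO' n).symm)
    have h1 := congrArg HahnSeries.order h
    rw [HahnSeries.order_mul he he'.1, HahnSeries.order_mul ho ho'.1, ← he'.2, ← ho'.2] at h1
    have h2 := congrArg (fun n => (ofLex n).2) h1
    simp only [ofLex_add, Prod.snd_add] at h2
    have h3 := ((hE _).1 (HahnSeries.coeff_order_eq_zero.not.2 he)).1
    have h4 := ((hO _).1 (HahnSeries.coeff_order_eq_zero.not.2 ho)).1
    exact absurd ((by omega : (ofLex (rep k f 0 0).order).2 = (ofLex (rep k f 0 1).order).2) ▸ h3) h4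

theorem shadow_eq_zero_of_rep {f : MonoidAlgebra k HeisCoord} (h : rep k f = 0) :
    shadow k f = 0 :=
  shadow_eq_zero_of_det k (by simp [h])

/-- Normal form of an element of the group algebra modulo `z + 1`. -/
noncomputable def residue : MonoidAlgebra k HeisCoord →ₗ[k] MonoidAlgebra k HeisCoord :=
  (Finsupp.lsum k fun g : HeisCoord =>
    LinearMap.toSpanSingleton k _ (((-1 : k) ^ g.c) • MonoidAlgebra.of k _ ⟨g.a, g.b, 0⟩)) ∘ₗ
    (MonoidAlgebra.coeffLinearEquiv k).toLinearMap

theorem residue_of (g : HeisCoord) :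
    residue k (MonoidAlgebra.of k _ g) = ((-1 : k) ^ g.c) • MonoidAlgebra.of k _ ⟨g.a, g.b, 0⟩ := by
  simp [residue]

theorem residue_coeff (f : MonoidAlgebra k HeisCoord) (g : HeisCoord) :
    (residue k f).coeff g = if g.c = 0 then (shadow k f).coeff (toLex (g.a, g.b)) else 0 := by
  induction f using MonoidAlgebra.induction_on with
  | of g' =>
    rw [residue_of, shadow_of, mon, HahnSeries.coeff_single]
    obtain ⟨a, b, c⟩ := g
    by_cases h : c = 0 <;> by_cases h1 : a = g'.a <;> by_cases h2 : b = g'.b <;>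
      simp [h, h1, h2, Ne.symm, eq_comm]
  | add x y hx hy =>
    simp only [map_add, MonoidAlgebra.coeff_add, Finsupp.add_apply, hx, hy, HahnSeries.coeff_add]
    split_ifs <;> simp
  | smul r x hx => simp [hx]

/-- The element `z + 1` of the group algebra. -/
noncomputable def zAddOne : MonoidAlgebra k HeisCoord := MonoidAlgebra.of k _ z + 1

theorem exists_sub_residue (f : MonoidAlgebra k HeisCoord) :
    ∃ q, f = residue k f + zAddOne k * q := by
  induction f using MonoidAlgebra.induction_on with
  | of g =>
    obtain ⟨a, b, c⟩ := g
    rw [residue_of]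
    have h0 : (-1 : k) ≠ 0 := by simp
    have hz (c : ℤ) : MonoidAlgebra.of k HeisCoord ⟨a, b, c + 1⟩ + MonoidAlgebra.of k _ ⟨a, b, c⟩ =
        zAddOne k * MonoidAlgebra.of k _ ⟨a, b, c⟩ := by
      rw [zAddOne, add_mul, one_mul, ← map_mul]
      congr 2
      ext <;> simp [add_comm]
    induction c using Int.induction_on with
    | zero => exact ⟨0, by simp⟩
    | succ i ih =>
      obtain ⟨q, hq⟩ := ih
      refine ⟨MonoidAlgebra.of k _ ⟨a, b, i⟩ - q, ?_⟩
      rw [mul_sub, ← hz, zpow_add_one₀ h0, mul_neg_one, neg_smul, eq_sub_of_add_eq' hq.symm]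
      abel
    | pred i ih =>
      obtain ⟨q, hq⟩ := ih
      refine ⟨MonoidAlgebra.of k _ ⟨a, b, -i - 1⟩ - q, ?_⟩
      rw [mul_sub, ← hz, zpow_sub_one₀ h0, sub_add_cancel, inv_neg_one, mul_neg_one, neg_smul,
        eq_sub_of_add_eq' hq.symm]
      abel
  | add x y hx hy =>
    obtain ⟨p, hp⟩ := hx
    obtain ⟨q, hq⟩ := hy
    refine ⟨p + q, ?_⟩
    rw [map_add, mul_add, add_add_add_comm, ← hp, ← hq]
  | smul r x hx =>
    obtain ⟨p, hp⟩ := hx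
    refine ⟨r • p, ?_⟩
    rw [map_smul, mul_smul_comm, ← smul_add, ← hp]

theorem exists_eq_zAddOne_mul {f : MonoidAlgebra k HeisCoord} (h : shadow k f = 0) :
    ∃ q, f = zAddOne k * q := by
  obtain ⟨q, hq⟩ := exists_sub_residue k f
  have : residue k f = 0 := by
    ext g
    simp [residue_coeff, h]
  exact ⟨q, by rwa [this, zero_add] at hq⟩

end HeisCoord

namespace HeisCoord

variable (k : Type*) [Field k]

theorem rep_zAddOne : rep k (zAddOne k) = 0 := by
  rw [zAddOne, map_add, map_one]
  refine Matrix.ext fun i l => ?_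
  rw [Matrix.add_apply, rep_of, Matrix.one_apply]
  fin_cases i <;> fin_cases l <;> simp [pauli, mon]
  all_goals exact neg_add_cancel _

/-- The slice of an element of the group algebra over a coset of the centre. -/
noncomputable def slice (a b : ℤ) : MonoidAlgebra k HeisCoord →ₗ[k] LaurentPolynomial k :=
  (Finsupp.lsum k fun g : HeisCoord =>
    LinearMap.toSpanSingleton k (LaurentPolynomial k)
      (if g.a = a ∧ g.b = b then LaurentPolynomial.T g.c else 0)) ∘ₗ
    (MonoidAlgebra.coeffLinearEquiv k).toLinearMap

theorem slice_of (a b : ℤ) (g : HeisCoord) : slice k a b (MonoidAlgebra.of k _ g) =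
    if g.a = a ∧ g.b = b then LaurentPolynomial.T g.c else 0 := by
  simp [slice]

theorem slice_zAddOne_mul (a b : ℤ) (f : MonoidAlgebra k HeisCoord) :
    slice k a b (zAddOne k * f) = (LaurentPolynomial.T 1 + 1) * slice k a b f := by
  induction f using MonoidAlgebra.induction_on with
  | of g =>
    rw [zAddOne, add_mul, one_mul, ← map_mul, map_add, slice_of, slice_of, add_mul, one_mul]
    by_cases h : g.a = a ∧ g.b = b
    · simp only [mul_a, mul_b, mul_c, z_a, z_b, z_c, zero_add, mul_zero, sub_zero, h, and_self,
        if_true, LaurentPolynomial.T_add]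
    · simp [h]
  | add x y hx hy => rw [mul_add, map_add, map_add, hx, hy, mul_add]
  | smul r x hx => rw [mul_smul_comm, map_smul, map_smul, hx, mul_smul_comm]

theorem T_coeff (m n : ℤ) :
    (LaurentPolynomial.T m : LaurentPolynomial k).coeff n = if m = n then 1 else 0 := by
  rw [LaurentPolynomial.T, AddMonoidAlgebra.coeff_single, Finsupp.single_apply]

theorem slice_coeff (f : MonoidAlgebra k HeisCoord) (a b c : ℤ) :
    (slice k a b f).coeff c = f.coeff ⟨a, b, c⟩ := by
  induction f using MonoidAlgebra.induction_on with
  | of g =>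
    rw [slice_of]
    obtain ⟨a', b', c'⟩ := g
    by_cases h : a' = a ∧ b' = b
    · obtain ⟨rfl, rfl⟩ := h
      rw [if_pos ⟨rfl, rfl⟩, T_coeff]
      by_cases h : c' = c <;> simp [h]
    · have : ¬ (a' = a ∧ b' = b ∧ c' = c) := fun h' => h ⟨h'.1, h'.2.1⟩
      simp [h, this]
  | add x y hx hy => simp [hx, hy]
  | smul r x hx => simp [hx]

theorem exists_slice_ne_zero {f : MonoidAlgebra k HeisCoord} (hf : f ≠ 0) :
    ∃ a b, slice k a b f ≠ 0 := by
  by_contra! h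
  apply hf
  ext g
  rw [← slice_coeff, h]
  rfl

theorem not_isUnit_T_add_one : ¬ IsUnit (LaurentPolynomial.T 1 + 1 : LaurentPolynomial k) := by
  intro h
  have := h.map (LaurentPolynomial.eval₂ (RingHom.id k) (-1 : kˣ))
  simp at this

theorem T_add_one_ne_zero : (LaurentPolynomial.T 1 + 1 : LaurentPolynomial k) ≠ 0 := by
  intro h
  have := congrArg (fun p : LaurentPolynomial k => p.coeff 1) h
  rw [← LaurentPolynomial.T_zero, AddMonoidAlgebra.coeff_add, Finsupp.add_apply, T_coeff,
    T_coeff] at this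
  simp at this

theorem eq_zero_of_zAddOne_mul {f : MonoidAlgebra k HeisCoord} (h : zAddOne k * f = 0) :
    f = 0 := by
  by_contra hf
  obtain ⟨a, b, hab⟩ := exists_slice_ne_zero k hf
  have := slice_zAddOne_mul k a b f
  rw [h, map_zero] at this
  exact mul_ne_zero (T_add_one_ne_zero k) hab this.symm

theorem exists_eq_pow_mul {f : MonoidAlgebra k HeisCoord} (hf : f ≠ 0) :
    ∃ n q, f = zAddOne k ^ n * q ∧ shadow k q ≠ 0 := by
  by_contra! h
  have key (n : ℕ) : ∃ q, f = zAddOne k ^ n * q := by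
    induction n with
    | zero => exact ⟨f, by simp⟩
    | succ n ih =>
      obtain ⟨q, hq⟩ := ih
      obtain ⟨q', hq'⟩ := exists_eq_zAddOne_mul k (h n q hq)
      exact ⟨q', by rw [hq, hq', pow_succ, mul_assoc]⟩
  obtain ⟨a, b, hab⟩ := exists_slice_ne_zero k hf
  have : IsNoetherianRing (LaurentPolynomial k) :=
    IsLocalization.isNoetherianRing (Submonoid.powers (Polynomial.X : Polynomial k)) _ inferInstance
  have hfin := FiniteMultiplicity.of_not_isUnit (not_isUnit_T_add_one k) hab
  obtain ⟨n, hn⟩ := hfin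
  obtain ⟨q, hq⟩ := key (n + 1)
  have hpow (m : ℕ) : slice k a b (zAddOne k ^ m * q) =
      (LaurentPolynomial.T 1 + 1) ^ m * slice k a b q := by
    induction m with
    | zero => simp
    | succ m ih => rw [pow_succ', mul_assoc, slice_zAddOne_mul, ih, pow_succ', mul_assoc]
  exact hn ⟨_, hq ▸ hpow (n + 1)⟩

theorem isUnit_rep_of_shadow_ne_zero {f : MonoidAlgebra k HeisCoord} (h : shadow k f ≠ 0) :
    IsUnit (rep k f) := by
  rw [Matrix.isUnit_iff_isUnit_det, isUnit_iff_ne_zero]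
  exact fun h0 => h (shadow_eq_zero_of_det k h0)

/-- Elements of the group algebra which are invertible in the two-dimensional representation. -/
noncomputable def repUnits : Submonoid (MonoidAlgebra k HeisCoord) :=
  (IsUnit.submonoid _).comap (rep k)

theorem exists_ore {r s : MonoidAlgebra k HeisCoord} (hs : s ∈ repUnits k)
    (h : ∃ r' s', s' ≠ 0 ∧ s' * r = r' * s) :
    ∃ r', ∃ s' : repUnits k, (s' : MonoidAlgebra k HeisCoord) * r = r' * s := by
  obtain ⟨r', s', hs', e⟩ := h
  obtain ⟨n, q, rfl, hq⟩ := exists_eq_pow_mul k hs'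
  induction n generalizing r' with
  | zero => exact ⟨r', ⟨q, isUnit_rep_of_shadow_ne_zero k hq⟩, by simpa using e⟩
  | succ n ih =>
    have h0 : rep k r' = 0 := by
      have := congrArg (rep k) e
      rw [pow_succ', mul_assoc, mul_assoc, map_mul, rep_zAddOne, zero_mul, map_mul] at this
      exact (IsUnit.mul_left_eq_zero hs).1 this.symm
    obtain ⟨r₁, rfl⟩ := exists_eq_zAddOne_mul k (shadow_eq_zero_of_rep k h0)
    rw [pow_succ', mul_assoc, mul_assoc, mul_assoc, ← sub_eq_zero, ← mul_sub] at e
    have e1 := sub_eq_zero.1 (eq_zero_of_zAddOne_mul k e)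
    exact ih r₁ (by intro h1; rw [pow_succ', mul_assoc, h1, mul_zero] at hs'; exact hs' rfl)
      (by rw [← e1, mul_assoc])

/-- A division ring containing the group algebra contains a localization to which the
two-dimensional representation extends. -/
theorem exists_localization.{u, v} (k : Type u) [Field k]
    {D : Type v} [DivisionRing D] (Φ : MonoidAlgebra k HeisCoord →+* D)
    (hΦ : Function.Injective Φ)
    (hore : ∀ r s : MonoidAlgebra k HeisCoord, s ≠ 0 → ∃ r' s', s' ≠ 0 ∧ s' * r = r' * s) :
    ∃ (R : Type u) (_ : Ring R) (ι : MonoidAlgebra k HeisCoord →+* R)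
      (ρ : R →+* Matrix (Fin 2) (Fin 2) (CoeffField k)) (j : R →+* D), Function.Injective j ∧
      (∀ f, j (ι f) = Φ f) ∧ (∀ f, ρ (ι f) = rep k f) ∧ ∀ f, IsUnit (rep k f) → IsUnit (ι f) := by
  classical
  have hne (s : repUnits k) : (s : MonoidAlgebra k HeisCoord) ≠ 0 := fun h => by
    have : IsUnit (rep k s) := s.2
    simp [h] at this
  have ho (r : MonoidAlgebra k HeisCoord) (s : repUnits k) :=
    exists_ore k s.2 (hore r s (hne s))
  choose num den hnd using ho
  let _ : OreLocalization.OreSet (repUnits k) :=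
    { ore_right_cancel := fun r₁ r₂ s h => ⟨1, by
        have h1 : Φ (r₁ - r₂) * Φ s = 0 := by
          rw [← map_mul, sub_mul, h, sub_self, map_zero]
        have h2 : Φ (s : MonoidAlgebra k HeisCoord) ≠ 0 :=
          (map_ne_zero_iff Φ hΦ).2 (hne s)
        have h3 := (mul_eq_zero.1 h1).resolve_right h2
        rw [sub_eq_zero.1 ((map_eq_zero_iff Φ hΦ).1 h3)]⟩
      oreNum := num
      oreDenom := den
      ore_eq := hnd }
  let fD : repUnits k →* Dˣ :=
    { toFun := fun s => Units.mk0 (Φ s) ((map_ne_zero_iff Φ hΦ).2 (hne s))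
      map_one' := by ext; simp
      map_mul' := fun _ _ => by ext; simp }
  let fM : repUnits k →* (Matrix (Fin 2) (Fin 2) (CoeffField k))ˣ :=
    IsUnit.liftRight ((rep k).toRingHom.toMonoidHom.comp (repUnits k).subtype)
      fun s => (s.2 : IsUnit (rep k s))
  have hfD (s : repUnits k) : Φ s = fD s := rfl
  have hfM (s : repUnits k) : (rep k).toRingHom s = fM s := rfl
  refine ⟨OreLocalization (repUnits k) (MonoidAlgebra k HeisCoord), inferInstance,
    OreLocalization.numeratorRingHom, OreLocalization.universalHom (rep k).toRingHom fM hfM,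
    OreLocalization.universalHom Φ fD hfD, ?_, ?_, ?_, ?_⟩
  · rw [injective_iff_map_eq_zero]
    intro a
    induction a using OreLocalization.ind with
    | _ r s =>
      intro h
      rw [OreLocalization.universalHom_apply] at h
      have h1 : Φ r = 0 := (Units.mul_right_eq_zero _).1 h
      rw [(map_eq_zero_iff Φ hΦ).1 h1, OreLocalization.zero_oreDiv]
  · intro f; exact OreLocalization.universalHom_commutes ..
  · intro f; exact OreLocalization.universalHom_commutes ..
  · intro f hf
    exact OreLocalization.numerator_isUnit (⟨f, hf⟩ : repUnits k)

end HeisCoord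

/-- The Cayley transform of a skew element is unitary. -/
theorem exists_cayley_unit {R D : Type*} [Ring R] [Ring D] (j : R →+* D) (invol : D →+ D)
    (hmul : ∀ c d, invol (c * d) = invol d * invol c) (hone : invol 1 = 1) {s : R}
    (hs : invol (j s) = -j s) (hp : IsUnit (1 + s)) (hm : IsUnit (1 - s)) :
    ∃ u : Rˣ, (1 + s) * u = 1 - s ∧ j u * invol (j u) = 1 := by
  obtain ⟨p, hp⟩ := hp
  obtain ⟨m, hm⟩ := hm
  have hc : (1 + s) * (1 - s) = (1 - s) * (1 + s) := by noncomm_ring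
  have h1 : (1 + s) * ((m * p⁻¹ : Rˣ) : R) = 1 - s := by
    rw [Units.val_mul, ← mul_assoc, hm, hc, ← hp, mul_assoc, Units.mul_inv, mul_one]
  have h2 : ((m * p⁻¹ : Rˣ) : R) * (1 + s) = 1 - s := by
    rw [Units.val_mul, hm, ← hp, mul_assoc, Units.inv_mul, mul_one]
  refine ⟨m * p⁻¹, h1, ?_⟩
  have h3 : (1 - j s) * invol (j ↑(m * p⁻¹)) = 1 + j s := by
    have := congrArg invol (congrArg j h2)
    simpa only [map_mul, hmul, map_add, map_sub, map_one, hone, hs, sub_neg_eq_add,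
      ← sub_eq_add_neg] using this
  have h4 : IsUnit (1 + j s) := by
    simpa [hp] using p.isUnit.map j
  refine h4.mul_left_cancel ?_
  rw [← mul_assoc, mul_one]
  have h5 := congrArg j h1
  rw [map_mul, map_add, map_sub, map_one] at h5
  rw [h5, h3]

section Cayley

open Matrix

variable {K F O : Type*} [Field K] [Field F] [CommRing O]

theorem map_sq_of_sq (j : O →+* K) {A : Matrix (Fin 2) (Fin 2) O} {t : O}
    (hA : A * A = t • (1 : Matrix (Fin 2) (Fin 2) O)) :
    A.map j * A.map j = j t • (1 : Matrix (Fin 2) (Fin 2) K) := by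
  have := congrArg (fun B => j.mapMatrix B) hA
  simp only [map_mul, RingHom.mapMatrix_apply] at this
  rw [this]
  refine Matrix.ext fun i l => ?_
  simp [Matrix.one_apply, apply_ite j]

theorem diag_neg_sq (θ : O) : (!![θ, 0; 0, -θ] : Matrix _ _ O) * !![θ, 0; 0, -θ] =
    (θ * θ) • (1 : Matrix (Fin 2) (Fin 2) O) := by
  refine Matrix.ext fun i l => ?_
  fin_cases i <;> fin_cases l <;> simp

theorem antidiag_sq (τ : O) : (!![0, τ; τ, 0] : Matrix _ _ O) * !![0, τ; τ, 0] =
    (τ * τ) • (1 : Matrix (Fin 2) (Fin 2) O) := by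
  refine Matrix.ext fun i l => ?_
  fin_cases i <;> fin_cases l <;> simp

theorem cayley_matrix (j : O →+* K) {A : Matrix (Fin 2) (Fin 2) O} {t : O}
    (hA : A * A = t • (1 : Matrix (Fin 2) (Fin 2) O)) (ht : j t ≠ 1)
    {V : (Matrix (Fin 2) (Fin 2) K)ˣ}
    (hV : (1 + A.map j) * (V : Matrix (Fin 2) (Fin 2) K) = 1 - A.map j) :
    (V : Matrix (Fin 2) (Fin 2) K) = (1 - j t)⁻¹ • ((1 - A) * (1 - A)).map j ∧
    ((V⁻¹ : (Matrix (Fin 2) (Fin 2) K)ˣ) : Matrix (Fin 2) (Fin 2) K) =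
      (1 - j t)⁻¹ • ((1 + A) * (1 + A)).map j := by
  have hne : 1 - j t ≠ 0 := sub_ne_zero.2 ht.symm
  have hAA := map_sq_of_sq j hA
  have e1 : ((1 - A) * (1 - A)).map j = (1 - A.map j) * (1 - A.map j) := by
    rw [← RingHom.mapMatrix_apply, map_mul, map_sub, map_one, RingHom.mapMatrix_apply]
  have e2 : ((1 + A) * (1 + A)).map j = (1 + A.map j) * (1 + A.map j) := by
    rw [← RingHom.mapMatrix_apply, map_mul, map_add, map_one, RingHom.mapMatrix_apply]
  have hV' : (1 - A.map j) * ((V⁻¹ : (Matrix (Fin 2) (Fin 2) K)ˣ) : Matrix (Fin 2) (Fin 2) K) =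
      1 + A.map j := by
    rw [← hV, mul_assoc, Units.mul_inv, mul_one]
  have f1 : (1 - A.map j) * (1 + A.map j) = (1 - j t) • (1 : Matrix (Fin 2) (Fin 2) K) := by
    rw [sub_smul, one_smul, ← hAA]
    noncomm_ring
  have f2 : (1 + A.map j) * (1 - A.map j) = (1 - j t) • (1 : Matrix (Fin 2) (Fin 2) K) := by
    rw [sub_smul, one_smul, ← hAA]
    noncomm_ring
  constructor
  · rw [e1]
    nth_rewrite 2 [← hV]
    rw [← mul_assoc, f1, smul_mul_assoc, one_mul, smul_smul, inv_mul_cancel₀ hne, one_smul]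
  · rw [e2]
    nth_rewrite 2 [← hV']
    rw [← mul_assoc, f2, smul_mul_assoc, one_mul, smul_smul, inv_mul_cancel₀ hne, one_smul]

theorem isUnit_one_add_of_sq {A : Matrix (Fin 2) (Fin 2) K} {t : K}
    (hA : A * A = t • (1 : Matrix (Fin 2) (Fin 2) K)) (ht : t ≠ 1) : IsUnit (1 + A) := by
  refine IsUnit.of_mul_eq_one ((1 - t)⁻¹ • (1 - A)) ?_
  have hne : 1 - t ≠ 0 := sub_ne_zero.2 ht.symm
  rw [mul_smul_comm]
  have : (1 + A) * (1 - A) = (1 - t) • (1 : Matrix (Fin 2) (Fin 2) K) := by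
    rw [sub_smul, one_smul, ← hA]
    noncomm_ring
  rw [this, smul_smul, inv_mul_cancel₀ hne, one_smul]

/-- The Cayley transforms of `diag(θ, -θ)` and `antidiag(τ, τ)` generate a free group if `θ` and
`τ` specialize to `1`. -/
theorem cayley_lift_injective {j : O →+* K} (hj : Function.Injective j) (ε : O →+* F)
    (h2 : (2 : F) ≠ 0) {θ τ : O} (hθ : ε θ = 1) (hτ : ε τ = 1) (hθ1 : j (θ * θ) ≠ 1)
    (hτ1 : j (τ * τ) ≠ 1) (U : Bool → (Matrix (Fin 2) (Fin 2) K)ˣ)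
    (hu : (1 + (!![θ, 0; 0, -θ] : Matrix _ _ O).map j) * (U true : Matrix (Fin 2) (Fin 2) K) =
      1 - (!![θ, 0; 0, -θ] : Matrix _ _ O).map j)
    (hv : (1 + (!![0, τ; τ, 0] : Matrix _ _ O).map j) * (U false : Matrix (Fin 2) (Fin 2) K) =
      1 - (!![0, τ; τ, 0] : Matrix _ _ O).map j) :
    Function.Injective (FreeGroup.lift U) := by
  obtain ⟨u1, u2⟩ := cayley_matrix j (diag_neg_sq θ) hθ1 hu
  obtain ⟨v1, v2⟩ := cayley_matrix j (antidiag_sq τ) hτ1 hv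
  have h4 : (4 : F) ≠ 0 := by
    have : (4 : F) = 2 * 2 := by norm_num
    rw [this]
    exact mul_ne_zero h2 h2
  refine lift_injective_of_rank_one hj ε U
    (fun l => match l with
      | (true, true) => (1 - !![θ, 0; 0, -θ]) * (1 - !![θ, 0; 0, -θ])
      | (true, false) => (1 + !![θ, 0; 0, -θ]) * (1 + !![θ, 0; 0, -θ])
      | (false, true) => (1 - !![0, τ; τ, 0]) * (1 - !![0, τ; τ, 0])
      | (false, false) => (1 + !![0, τ; τ, 0]) * (1 + !![0, τ; τ, 0]))
    (fun l => bif l.1 then (1 - j (θ * θ))⁻¹ else (1 - j (τ * τ))⁻¹)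
    (fun l => bif l.1 then 4 else 2)
    (fun l => match l with
      | (true, true) => ![0, 1]
      | (true, false) => ![1, 0]
      | (false, true) => ![1, -1]
      | (false, false) => ![1, 1]) ?_ ?_ ?_ ?_ ?_
  · rintro ⟨_ | _, _ | _⟩
    · exact v2
    · exact v1
    · exact u2
    · exact u1
  · rintro ⟨_ | _, _ | _⟩ <;> refine Matrix.ext fun i l => ?_ <;> fin_cases i <;> fin_cases l <;>
      simp [Matrix.mul_apply, Matrix.one_apply, hθ, hτ] <;> norm_num
  · rintro ⟨_ | _, _ | _⟩ <;> simp [h2, h4]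
  · rintro ⟨_ | _, _ | _⟩ ⟨_ | _, _ | _⟩ h <;> simp at h <;> simp [one_add_one_eq_two, h2]
  · rintro ⟨_ | _, _ | _⟩ h <;> simpa using And.intro (congrFun h 0) (congrFun h 1)

end Cayley

namespace HeisCoord

/-- Two skew elements of the group algebra in good position give a free unitary pair. -/
theorem exists_free_unitary {k D F O : Type*} [Field k] [DivisionRing D] [Field F] [CommRing O]
    (Φ : MonoidAlgebra k HeisCoord →+* D) (hΦ : Function.Injective Φ)
    (hore : ∀ r s : MonoidAlgebra k HeisCoord, s ≠ 0 → ∃ r' s', s' ≠ 0 ∧ s' * r = r' * s)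
    (invol : D →+ D) (hmul : ∀ c d, invol (c * d) = invol d * invol c) (hone : invol 1 = 1)
    {j : O →+* CoeffField k} (hj : Function.Injective j) (ε : O →+* F) (h2 : (2 : F) ≠ 0)
    {θ τ : O} (hθ : ε θ = 1) (hτ : ε τ = 1) (hθ1 : j (θ * θ) ≠ 1) (hτ1 : j (τ * τ) ≠ 1)
    (s t : MonoidAlgebra k HeisCoord) (hs : invol (Φ s) = -Φ s) (ht : invol (Φ t) = -Φ t)
    (hrs : rep k s = (!![θ, 0; 0, -θ] : Matrix _ _ O).map j)
    (hrt : rep k t = (!![0, τ; τ, 0] : Matrix _ _ O).map j) :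
    ∃ u v : Dˣ, IsFreePair u v ∧ (u : D) * invol (u : D) = 1 ∧ (v : D) * invol (v : D) = 1 := by
  obtain ⟨R, _, ι, ρ, i, hi, hiι, hρι, hunit⟩ := exists_localization k Φ hΦ hore
  have sq1 : rep k s * rep k s = j (θ * θ) • 1 := by
    rw [hrs, map_sq_of_sq j (diag_neg_sq θ)]
  have sq2 : rep k t * rep k t = j (τ * τ) • 1 := by
    rw [hrt, map_sq_of_sq j (antidiag_sq τ)]
  have key {a : MonoidAlgebra k HeisCoord} {r : CoeffField k} (ha : rep k a * rep k a = r • 1)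
      (hr : r ≠ 1) : IsUnit (1 + ι a) := by
    rw [← map_one ι, ← map_add]
    apply hunit
    rw [map_add, map_one]
    exact isUnit_one_add_of_sq ha hr
  have key' {a : MonoidAlgebra k HeisCoord} {r : CoeffField k} (ha : rep k a * rep k a = r • 1)
      (hr : r ≠ 1) : IsUnit (1 - ι a) := by
    rw [sub_eq_add_neg, ← map_neg]
    exact key (by simpa using ha) hr
  obtain ⟨u, hu, hu1⟩ := exists_cayley_unit i invol hmul hone (by rw [hiι, hs])
    (key sq1 hθ1) (key' sq1 hθ1)
  obtain ⟨v, hv, hv1⟩ := exists_cayley_unit i invol hmul hone (by rw [hiι, ht])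
    (key sq2 hτ1) (key' sq2 hτ1)
  refine ⟨Units.map (i : R →* D) u, Units.map (i : R →* D) v,
    isFreePair_map_of_lift_injective ρ hi u v ?_, hu1, hv1⟩
  refine cayley_lift_injective hj ε h2 hθ hτ hθ1 hτ1 _ ?_ ?_
  · simpa [hρι, hrs] using congrArg ρ hu
  · simpa [hρι, hrt] using congrArg ρ hv

end HeisCoord

namespace HeisCoord

open Matrix

variable (k : Type*) [Field k]

/-- The ring of finite sums of monomials. -/
abbrev FinRing : Type _ := AddMonoidAlgebra k (ℤ ×ₗ ℤ)

/-- A monomial in the ring of finite sums. -/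
noncomputable def finMon {k : Type*} [Field k] (m n : ℤ) : FinRing k :=
  AddMonoidAlgebra.single (toLex (m, n)) 1

/-- The embedding of finite sums of monomials into Hahn series. -/
noncomputable def toSeries : FinRing k →ₐ[k] CoeffField k :=
  AddMonoidAlgebra.lift k _ _
    { toFun := fun n => HahnSeries.single n.toAdd 1
      map_one' := rfl
      map_mul' := fun m n => by simp [HahnSeries.single_mul_single] }

theorem toSeries_single (n : ℤ ×ₗ ℤ) (r : k) :
    toSeries k (AddMonoidAlgebra.single n r) = HahnSeries.single n r := by
  rw [toSeries, AddMonoidAlgebra.lift_single]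
  change r • HahnSeries.single n (1 : k) = _
  rw [← HahnSeries.single_zero_mul_eq_smul, HahnSeries.single_mul_single, zero_add, mul_one]

theorem toSeries_finMon (m n : ℤ) : toSeries k (finMon m n) = mon m n 1 :=
  toSeries_single ..

theorem toSeries_coeff (p : FinRing k) (n : ℤ ×ₗ ℤ) : (toSeries k p).coeff n = p.coeff n := by
  induction p using AddMonoidAlgebra.induction_linear with
  | zero => simp
  | add f g hf hg => simp [hf, hg]
  | single m r =>
    rw [toSeries_single, HahnSeries.coeff_single, AddMonoidAlgebra.coeff_single,
      Finsupp.single_apply]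
    by_cases h : n = m
    · simp [h]
    · simp [h, Ne.symm h]

theorem toSeries_injective : Function.Injective (toSeries k) := fun p q h => by
  ext n
  rw [← toSeries_coeff, h, toSeries_coeff]

theorem toSeries_sq_ne_one (m n m' n' : ℤ) (h : m ≠ 0 ∨ n ≠ 0) (h' : m' ≠ 0 ∨ n' ≠ 0) :
    toSeries k ((finMon m n - finMon m' n') * (finMon m n - finMon m' n')) ≠ 1 := by
  intro h1
  have h0 : (toSeries k (finMon m n - finMon m' n')).coeff 0 = 0 := by
    have e (a b : ℤ) (hab : a ≠ 0 ∨ b ≠ 0) : toLex (a, b) ≠ (0 : ℤ ×ₗ ℤ) := fun h =>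
      hab.elim (fun ha => ha (congrArg (fun p => (ofLex p).1) h))
        fun hb => hb (congrArg (fun p => (ofLex p).2) h)
    rw [toSeries_coeff, finMon, finMon]
    simp [e _ _ h, e _ _ h']
  rw [map_mul, mul_self_eq_one_iff] at h1
  rcases h1 with h1 | h1 <;> simp [h1] at h0

variable {k}

/-- Evaluation of finite sums of monomials at a pair of units. -/
noncomputable def evalAt {F : Type*} [Field F] [Algebra k F] (s t : Fˣ) : FinRing k →ₐ[k] F :=
  AddMonoidAlgebra.lift k _ _
    { toFun := fun n => ((s ^ (ofLex n.toAdd).1 * t ^ (ofLex n.toAdd).2 : Fˣ) : F)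
      map_one' := by simp
      map_mul' := fun m n => by
        rw [← Units.val_mul]
        congr 1
        simp only [toAdd_mul, ofLex_add, Prod.fst_add, Prod.snd_add, _root_.zpow_add]
        exact mul_mul_mul_comm .. }

theorem evalAt_finMon {F : Type*} [Field F] [Algebra k F] (s t : Fˣ) (m n : ℤ) :
    evalAt s t (finMon m n : FinRing k) = (s : F) ^ m * (t : F) ^ n := by
  simp [evalAt, finMon]

theorem two_ne_zero_algebraicClosure (hchar : ringChar k ≠ 2) : (2 : AlgebraicClosure k) ≠ 0 := by
  have h : (2 : k) ≠ 0 := Ring.two_ne_zero hchar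
  rw [← map_ofNat (algebraMap k (AlgebraicClosure k)) 2]
  exact (map_ne_zero _).2 h

/-- Free unitary pairs when both generators are unitary. -/
theorem exists_free_unitary_of_inv_inv {D : Type*} [DivisionRing D]
    (hchar : ringChar k ≠ 2)
    (Φ : MonoidAlgebra k HeisCoord →+* D) (hΦ : Function.Injective Φ)
    (hore : ∀ r s : MonoidAlgebra k HeisCoord, s ≠ 0 → ∃ r' s', s' ≠ 0 ∧ s' * r = r' * s)
    (invol : D →+ D) (hmul : ∀ c d, invol (c * d) = invol d * invol c) (hone : invol 1 = 1)
    (hx : invol (Φ (.of k _ x)) = Φ (.of k _ x⁻¹)) (hx' : invol (Φ (.of k _ x⁻¹)) = Φ (.of k _ x))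
    (hy : invol (Φ (.of k _ y)) = Φ (.of k _ y⁻¹))
    (hy' : invol (Φ (.of k _ y⁻¹)) = Φ (.of k _ y)) :
    ∃ u v : Dˣ, IsFreePair u v ∧ (u : D) * invol (u : D) = 1 ∧ (v : D) * invol (v : D) = 1 := by
  obtain ⟨w, hw⟩ : ∃ w : AlgebraicClosure k, w ^ 2 - w - 1 = 0 := by
    obtain ⟨w, hw⟩ := IsAlgClosed.exists_root
      (Polynomial.X ^ 2 - Polynomial.X - 1 : Polynomial (AlgebraicClosure k))
      (by
        have : (Polynomial.X ^ 2 - Polynomial.X - 1 :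
            Polynomial (AlgebraicClosure k)).degree = 2 := by compute_degree!
        rw [this]; decide)
    exact ⟨w, by simpa using hw⟩
  have hw0 : w ≠ 0 := by
    rintro rfl
    simp at hw
  have hw1 : w - w⁻¹ = 1 := by
    field_simp
    linear_combination hw
  refine exists_free_unitary Φ hΦ hore invol hmul hone (j := (toSeries k).toRingHom)
    (toSeries_injective k) (evalAt (Units.mk0 w hw0) (Units.mk0 w hw0)).toRingHom
    (two_ne_zero_algebraicClosure hchar)
    (θ := finMon 1 0 - finMon (-1) 0) (τ := finMon 0 1 - finMon 0 (-1)) ?_ ?_ ?_ ?_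
    (.of k _ x - .of k _ x⁻¹) (.of k _ y - .of k _ y⁻¹) ?_ ?_ ?_ ?_
  · simp [evalAt_finMon, hw1]
  · simp [evalAt_finMon, hw1]
  · exact toSeries_sq_ne_one k _ _ _ _ (by simp) (by simp)
  · exact toSeries_sq_ne_one k _ _ _ _ (by simp) (by simp)
  · simp only [map_sub, hx, hx', neg_sub]
  · simp only [map_sub, hy, hy', neg_sub]
  · rw [map_sub]
    refine Matrix.ext fun i l => ?_
    rw [Matrix.sub_apply, rep_of, rep_of]
    fin_cases i <;> fin_cases l <;> simp [pauli, toSeries_finMon] <;> simp [mon, neg_add_eq_sub]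
  · rw [map_sub]
    refine Matrix.ext fun i l => ?_
    rw [Matrix.sub_apply, rep_of, rep_of]
    fin_cases i <;> fin_cases l <;> simp [pauli, toSeries_finMon] <;> simp [mon]

/-- Free unitary pairs when the first generator is symmetric and the second one is unitary. -/
theorem exists_free_unitary_of_self_inv {D : Type*} [DivisionRing D]
    (hchar : ringChar k ≠ 2)
    (Φ : MonoidAlgebra k HeisCoord →+* D) (hΦ : Function.Injective Φ)
    (hore : ∀ r s : MonoidAlgebra k HeisCoord, s ≠ 0 → ∃ r' s', s' ≠ 0 ∧ s' * r = r' * s)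
    (invol : D →+ D) (hmul : ∀ c d, invol (c * d) = invol d * invol c) (hone : invol 1 = 1)
    (hx : invol (Φ (.of k _ x)) = Φ (.of k _ x))
    (hy : invol (Φ (.of k _ y)) = Φ (.of k _ y⁻¹))
    (hy' : invol (Φ (.of k _ y⁻¹)) = Φ (.of k _ y)) :
    ∃ u v : Dˣ, IsFreePair u v ∧ (u : D) * invol (u : D) = 1 ∧ (v : D) * invol (v : D) = 1 := by
  obtain ⟨w, hw⟩ : ∃ w : AlgebraicClosure k, w ^ 3 - (w ^ 2 - 1) * (w ^ 2 + 1) ^ 2 = 0 := by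
    obtain ⟨w, hw⟩ := IsAlgClosed.exists_root
      (Polynomial.X ^ 3 - (Polynomial.X ^ 2 - 1) * (Polynomial.X ^ 2 + 1) ^ 2 :
        Polynomial (AlgebraicClosure k))
      (by
        have : (Polynomial.X ^ 3 - (Polynomial.X ^ 2 - 1) * (Polynomial.X ^ 2 + 1) ^ 2 :
            Polynomial (AlgebraicClosure k)).degree = 6 := by compute_degree!
        rw [this]; decide)
    exact ⟨w, by simpa using hw⟩
  have hw0 : w ≠ 0 := by
    rintro rfl
    simp at hw
  have hw1 : w ^ 2 - 1 ≠ 0 := fun h => by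
    rw [h] at hw
    simp [hw0] at hw
  have hw2 : w ^ 2 + 1 ≠ 0 := fun h => by
    rw [h] at hw
    simp [hw0] at hw
  have hv0 : w ^ 2 / ((w ^ 2 - 1) * (w ^ 2 + 1)) ≠ 0 :=
    div_ne_zero (pow_ne_zero _ hw0) (mul_ne_zero hw1 hw2)
  refine exists_free_unitary Φ hΦ hore invol hmul hone (j := (toSeries k).toRingHom)
    (toSeries_injective k) (evalAt (Units.mk0 _ hv0) (Units.mk0 w hw0)).toRingHom
    (two_ne_zero_algebraicClosure hchar)
    (θ := finMon 1 2 - finMon 1 (-2)) (τ := finMon 2 1 - finMon 2 (-1)) ?_ ?_ ?_ ?_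
    (.of k _ x * .of k _ y * .of k _ y - .of k _ y⁻¹ * .of k _ y⁻¹ * .of k _ x)
    (.of k _ x * .of k _ y⁻¹ * .of k _ x - .of k _ x * .of k _ y * .of k _ x) ?_ ?_ ?_ ?_
  · simp [evalAt_finMon]
    field_simp
    ring
  · simp [evalAt_finMon]
    field_simp
    linear_combination hw
  · exact toSeries_sq_ne_one k _ _ _ _ (by simp) (by simp)
  · exact toSeries_sq_ne_one k _ _ _ _ (by simp) (by simp)
  · simp only [map_sub, map_mul, hmul, hx, hy, hy', neg_sub, mul_assoc]
  · simp only [map_sub, map_mul, hmul, hx, hy, hy', neg_sub, mul_assoc]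
  · simp only [← map_mul]
    rw [map_sub]
    refine Matrix.ext fun i l => ?_
    rw [Matrix.sub_apply, rep_of, rep_of]
    fin_cases i <;> fin_cases l <;> simp [pauli, toSeries_finMon] <;> simp [mon, neg_add_eq_sub]
  · simp only [← map_mul]
    rw [map_sub]
    refine Matrix.ext fun i l => ?_
    rw [Matrix.sub_apply, rep_of, rep_of]
    fin_cases i <;> fin_cases l <;> simp [pauli, toSeries_finMon] <;> simp [mon, neg_add_eq_sub]

end HeisCoord

section Transfer

variable {k G H : Type*} [Field k] [Group G] [Group H]

/-- Extracting a coset of a subgroup is linear over the group algebra of the subgroup. -/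
theorem comapDomain_mul_mapDomain {ψ : H →* G} (γ : G)
    (hψ : Function.Injective fun h => γ * ψ h) (f : MonoidAlgebra k G) (r : MonoidAlgebra k H) :
    MonoidAlgebra.comapDomain (fun h => γ * ψ h) hψ (f * MonoidAlgebra.mapDomainAlgHom k k ψ r) =
      MonoidAlgebra.comapDomain (fun h => γ * ψ h) hψ f * r := by
  induction r using MonoidAlgebra.induction_on with
  | of h =>
    ext x
    simp [mul_assoc]
  | add x y hx hy => rw [map_add, mul_add, MonoidAlgebra.comapDomain_add, hx, hy, mul_add]
  | smul c x hx =>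
    rw [map_smul, mul_smul_comm, mul_smul_comm, ← hx]
    ext
    simp

/-- The left Ore condition passes to the group algebra of a subgroup. -/
theorem exists_ore_of_injective {ψ : H →* G} (hψ : Function.Injective ψ)
    (hore : ∀ r s : MonoidAlgebra k G, s ≠ 0 → ∃ r' s', s' ≠ 0 ∧ s' * r = r' * s)
    (r s : MonoidAlgebra k H) (hs : s ≠ 0) : ∃ r' s', s' ≠ 0 ∧ s' * r = r' * s := by
  have hinj : Function.Injective (MonoidAlgebra.mapDomainAlgHom k k ψ) :=
    MonoidAlgebra.mapDomain_injective hψ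
  obtain ⟨a, b, hb, e⟩ := hore (MonoidAlgebra.mapDomainAlgHom k k ψ r)
    (MonoidAlgebra.mapDomainAlgHom k k ψ s) ((map_ne_zero_iff _ hinj).2 hs)
  obtain ⟨γ, hγ⟩ : ∃ γ, b.coeff γ ≠ 0 := by
    by_contra! h
    exact hb (by ext γ; simp [h])
  have hγψ : Function.Injective fun h => γ * ψ h := (mul_right_injective γ).comp hψ
  refine ⟨MonoidAlgebra.comapDomain _ hγψ a, MonoidAlgebra.comapDomain _ hγψ b, fun h => hγ ?_, ?_⟩
  · have := congrArg (fun f => f.coeff 1) h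
    simpa using this
  · rw [← comapDomain_mul_mapDomain, e, comapDomain_mul_mapDomain]

/-- A division ring of (right) quotients with an involution gives the left Ore condition. -/
theorem exists_ore_of_involution {D : Type*} [DivisionRing D] [Algebra k D]
    (Φ : MonoidAlgebra k G →ₐ[k] D) (hΦ : Function.Injective Φ)
    (hquot : ∀ d : D, ∃ a b : MonoidAlgebra k G, Φ b ≠ 0 ∧ d = Φ a * (Φ b)⁻¹)
    (st : G → G) (invol : D →ₗ[k] D) (hmul : ∀ c d, invol (c * d) = invol d * invol c)
    (hinv : ∀ c, invol (invol c) = c)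
    (hind : ∀ g, invol (Φ (.of k G g)) = Φ (.of k G (st g)))
    (r s : MonoidAlgebra k G) (hs : s ≠ 0) : ∃ r' s', s' ≠ 0 ∧ s' * r = r' * s := by
  have himage (f : MonoidAlgebra k G) : ∃ f', invol (Φ f) = Φ f' := by
    induction f using MonoidAlgebra.induction_on with
    | of g => exact ⟨_, hind g⟩
    | add x y hx hy =>
      obtain ⟨x', hx⟩ := hx
      obtain ⟨y', hy⟩ := hy
      exact ⟨x' + y', by rw [map_add, map_add, hx, hy, map_add]⟩
    | smul c x hx =>
      obtain ⟨x', hx⟩ := hx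
      exact ⟨c • x', by rw [map_smul, map_smul, hx, map_smul]⟩
  have hs' : Φ s ≠ 0 := (map_ne_zero_iff _ hΦ).2 hs
  obtain ⟨a, b, hb, e⟩ := hquot (invol (Φ r * (Φ s)⁻¹))
  obtain ⟨a', ha'⟩ := himage a
  obtain ⟨b', hb'⟩ := himage b
  have h1 := congrArg invol ((eq_mul_inv_iff_mul_eq₀ hb).1 e)
  rw [hmul, hinv, ha', hb', ← mul_assoc] at h1
  refine ⟨a', b', fun h => hb ?_, hΦ ?_⟩
  · rw [h, map_zero] at hb'
    rw [← hinv (Φ b), hb', map_zero]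
  · rw [map_mul, map_mul, ← h1, mul_assoc, inv_mul_cancel₀ hs', mul_one]

end Transfer

namespace HeisCoord

theorem commute_commS (g h l : HeisCoord) : Commute (commS g h) l := by
  rw [commS_eq]
  exact commute_of_central l _

/-- The endomorphism of the Heisenberg group determined by the images of the generators. -/
def endo (g h : HeisCoord) : HeisCoord →* HeisCoord :=
  lift g h _ rfl (commute_commS g h g) (commute_commS g h h)

theorem endo_apply (g h p : HeisCoord) :
    endo g h p = g ^ p.a * h ^ p.b * commS g h ^ p.c := rfl

theorem endo_x (g h : HeisCoord) : endo g h x = g := by simp [endo_apply]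

theorem endo_y (g h : HeisCoord) : endo g h y = h := by simp [endo_apply]

theorem endo_injective {g h : HeisCoord} (hδ : g.a * h.b - h.a * g.b ≠ 0) :
    Function.Injective (endo g h) := by
  rw [injective_iff_map_eq_one]
  intro p hp
  rw [endo_apply, commS_eq, central_zpow] at hp
  have ha : p.a * g.a + p.b * h.a = 0 := by simpa using congrArg HeisCoord.a hp
  have hb : p.a * g.b + p.b * h.b = 0 := by simpa using congrArg HeisCoord.b hp
  have ha0 : p.a = 0 := by
    refine (mul_eq_zero.1 ?_).resolve_right hδ
    linear_combination h.b * ha - h.a * hb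
  have hb0 : p.b = 0 := by
    refine (mul_eq_zero.1 ?_).resolve_right hδ
    linear_combination g.a * hb - g.b * ha
  have hc0 : p.c = 0 := by
    refine (mul_eq_zero.1 ?_).resolve_right hδ
    simpa [ha0, hb0] using congrArg HeisCoord.c hp
  ext <;> simp [ha0, hb0, hc0]

section Automorphism

variable (τ : HeisCoord →* HeisCoord)

theorem map_z : τ z = ⟨0, 0, (τ x).a * (τ y).b - (τ y).a * (τ x).b⟩ := by
  have h : z = commS x y := by
    rw [commS_eq]
    rfl
  have h' : τ (commS x y) = commS (τ x) (τ y) := by simp [commS]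
  rw [h, h', commS_eq]

theorem map_a (g : HeisCoord) : (τ g).a = g.a * (τ x).a + g.b * (τ y).a := by
  nth_rewrite 1 [eq_prod g]
  rw [map_mul, map_mul, map_zpow, map_zpow, map_zpow, map_z, central_zpow]
  simp

theorem map_b (g : HeisCoord) : (τ g).b = g.a * (τ x).b + g.b * (τ y).b := by
  nth_rewrite 1 [eq_prod g]
  rw [map_mul, map_mul, map_zpow, map_zpow, map_zpow, map_z, central_zpow]
  simp

/-- An involutive automorphism other than inversion modulo the centre admits an independent pair
consisting of an element which is fixed or inverted and an element which is fixed. -/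
theorem exists_pair (hτ : ∀ g, τ (τ g) = g)
    (hne : ¬ ((τ x).a = -1 ∧ (τ x).b = 0 ∧ (τ y).a = 0 ∧ (τ y).b = -1)) :
    ∃ g h, g.a * h.b - h.a * g.b ≠ 0 ∧ (τ g = g ∨ τ g = g⁻¹) ∧ τ h = h := by
  have hxa := map_a τ (τ x)
  have hxb := map_b τ (τ x)
  have hya := map_a τ (τ y)
  have hyb := map_b τ (τ y)
  rw [hτ] at hxa hxb hya hyb
  simp only [x_a, x_b, y_a, y_b] at hxa hxb hya hyb
  have hz := map_z τ
  generalize ha : (τ x).a = a at *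
  generalize hb : (τ x).b = b at *
  generalize hc : (τ y).a = c at *
  generalize hd : (τ y).b = d at *
  by_cases had : a + d = 0
  · obtain rfl : d = -a := by omega
    have hz' (n : ℤ) : τ ⟨0, 0, n⟩ = ⟨0, 0, -n⟩ := by
      have : a * -a - c * b = -1 := by linarith
      rw [← z_zpow, map_zpow, hz, this, central_zpow, mul_neg_one]
    have hanti (γ : HeisCoord) : τ (γ * (τ γ)⁻¹) = (γ * (τ γ)⁻¹)⁻¹ := by
      rw [map_mul, map_inv, hτ, mul_inv_rev, inv_inv]
    have hfix (γ : HeisCoord) : ∃ n : ℤ, τ (γ * τ γ * (γ * τ γ) * ⟨0, 0, n⟩) =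
        γ * τ γ * (γ * τ γ) * ⟨0, 0, n⟩ := by
      have h1 : τ (γ * τ γ) = γ * τ γ * ⟨0, 0, (τ γ * γ).c - (γ * τ γ).c⟩ := by
        rw [map_mul, hτ]
        ext <;> simp [add_comm]
      refine ⟨(τ γ * γ).c - (γ * τ γ).c, ?_⟩
      generalize (τ γ * γ).c - (γ * τ γ).c = n at h1 ⊢
      rw [map_mul, map_mul, h1, hz']
      ext <;> simp
      ring
    have hpair (γ γ' : HeisCoord) (hδ : (γ.a - (τ γ).a) * (γ'.b + (τ γ').b) -
        (γ'.a + (τ γ').a) * (γ.b - (τ γ).b) ≠ 0) :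
        ∃ g h, g.a * h.b - h.a * g.b ≠ 0 ∧ (τ g = g ∨ τ g = g⁻¹) ∧ τ h = h := by
      obtain ⟨n, hn⟩ := hfix γ'
      refine ⟨_, _, fun h => hδ ?_, Or.inr (hanti γ), hn⟩
      simp only [mul_a, mul_b, inv_a, inv_b] at h
      linarith
    by_cases hb0 : b = 0
    · subst hb0
      have : (a - 1) * (a + 1) = 0 := by linarith
      rcases mul_eq_zero.1 this with h1 | h1
      · exact hpair y x (by simp [ha, hb, hc, hd]; omega)
      · exact hpair x y (by simp [ha, hb, hc, hd]; omega)
    · refine hpair x x ?_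
      simp only [ha, hb, x_a, x_b]
      intro h
      exact hb0 (by linarith)
  · have hb0 : b = 0 := by
      refine (mul_eq_zero.1 ?_).resolve_right had
      linarith
    have hc0 : c = 0 := by
      refine (mul_eq_zero.1 ?_).resolve_right had
      linarith
    subst hb0 hc0
    have h1 : (a - 1) * (a + 1) = 0 := by linarith
    have h2 : (d - 1) * (d + 1) = 0 := by linarith
    rw [mul_eq_zero] at h1 h2
    obtain ⟨rfl, rfl⟩ : a = 1 ∧ d = 1 := by omega
    have hfix (γ : HeisCoord) (h1 : (τ γ).a = γ.a) (h2 : (τ γ).b = γ.b) : τ γ = γ := by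
      have e : τ γ = γ * z ^ ((τ γ).c - γ.c) := by
        ext <;> simp [h1, h2]
      have e' := congrArg τ e
      rw [hτ, map_mul, map_zpow, hz] at e'
      have := congrArg HeisCoord.c e'
      simp only [mul_c, central_zpow] at this
      have h3 : (τ γ).c = γ.c := by linarith
      ext <;> assumption
    exact ⟨x, y, by simp, Or.inl (hfix x (by simp [ha]) (by simp [hb])),
      hfix y (by simp [hc]) (by simp [hd])⟩

end Automorphism

theorem exists_free_unitary_of_quotients {k : Type*} [Field k] (hchar : ringChar k ≠ 2)
    {D : Type*} [DivisionRing D] [Algebra k D] (Φ : MonoidAlgebra k HeisCoord →ₐ[k] D)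
    (hΦ : Function.Injective Φ)
    (hquot : ∀ d : D, ∃ a b : MonoidAlgebra k HeisCoord, Φ b ≠ 0 ∧ d = Φ a * (Φ b)⁻¹)
    (st : HeisCoord → HeisCoord) (hst : ∀ g h, st (g * h) = st h * st g)
    (hst' : ∀ g, st (st g) = g) (invol : D →ₗ[k] D)
    (hmul : ∀ c d, invol (c * d) = invol d * invol c) (hinv : ∀ c, invol (invol c) = c)
    (hind : ∀ g, invol (Φ (.of k _ g)) = Φ (.of k _ (st g)))
    (hnotI : ¬ ∃ m n : ℤ, st x = z ^ m * x ∧ st y = z ^ n * y) :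
    ∃ u v : Dˣ, IsFreePair u v ∧ (u : D) * invol (u : D) = 1 ∧ (v : D) * invol (v : D) = 1 := by
  have hone : invol 1 = 1 := by
    have := hmul 1 (invol 1)
    rwa [one_mul, hinv, one_mul, eq_comm] at this
  have hore := exists_ore_of_involution Φ hΦ hquot st invol hmul hinv hind
  let τ : HeisCoord →* HeisCoord := MonoidHom.mk' (fun g => (st g)⁻¹) fun g h => by
    rw [hst, mul_inv_rev]
  have hτst (g : HeisCoord) : st g = (τ g)⁻¹ := (inv_inv _).symm
  have hτ (g : HeisCoord) : τ (τ g) = g := by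
    have h := hst' g
    rwa [hτst, hτst, map_inv, inv_inv] at h
  obtain ⟨g, h, hδ, hg, hh⟩ := exists_pair τ hτ (by
    rintro ⟨h1, h2, h3, h4⟩
    refine hnotI ⟨-(τ x).c, -(τ y).c, ?_, ?_⟩
    · rw [hτst]
      ext <;> simp [h1, h2]
    · rw [hτst]
      ext <;> simp [h3, h4])
  have hψ := endo_injective hδ
  let E := MonoidAlgebra.mapDomainAlgHom k k (endo g h)
  have hEx : E (.of k _ x) = .of k _ g := by simp [E, endo_x]
  have hEx' : E (.of k _ x⁻¹) = .of k _ g⁻¹ := by simp [E, endo_x]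
  have hEy : E (.of k _ y) = .of k _ h := by simp [E, endo_y]
  have hEy' : E (.of k _ y⁻¹) = .of k _ h⁻¹ := by simp [E, endo_y]
  have hE : Function.Injective ((Φ.comp E : MonoidAlgebra k HeisCoord →ₐ[k] D).toRingHom) :=
    hΦ.comp (MonoidAlgebra.mapDomain_injective hψ)
  have hore' := exists_ore_of_injective hψ hore
  rcases hg with hg | hg
  · refine exists_free_unitary_of_inv_inv hchar _ hE hore' invol.toAddMonoidHom hmul hone
      ?_ ?_ ?_ ?_
    · change invol (Φ (E _)) = Φ (E _)
      rw [hEx, hEx', hind, hτst, hg]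
    · change invol (Φ (E _)) = Φ (E _)
      rw [hEx, hEx', hind, hτst, map_inv τ, hg, inv_inv]
    · change invol (Φ (E _)) = Φ (E _)
      rw [hEy, hEy', hind, hτst, hh]
    · change invol (Φ (E _)) = Φ (E _)
      rw [hEy, hEy', hind, hτst, map_inv τ, hh, inv_inv]
  · refine exists_free_unitary_of_self_inv hchar _ hE hore' invol.toAddMonoidHom hmul hone ?_ ?_ ?_
    · change invol (Φ (E _)) = Φ (E _)
      rw [hEx, hind, hτst, hg, inv_inv]
    · change invol (Φ (E _)) = Φ (E _)
      rw [hEy, hEy', hind, hτst, hh]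
    · change invol (Φ (E _)) = Φ (E _)
      rw [hEy, hEy', hind, hτst, map_inv τ, hh, inv_inv]

end HeisCoord

theorem commute_Hlam_Hx : Commute Hlam Hx := by
  have h : commS Hlam Hx = 1 :=
    (PresentedGroup.mk_eq_one_iff).2 (Subgroup.subset_normalClosure (Or.inl rfl))
  rw [commS, mul_assoc, ← mul_inv_rev, inv_mul_eq_one] at h
  exact h.symm

theorem commute_Hlam_Hy : Commute Hlam Hy := by
  have h : commS Hlam Hy = 1 :=
    (PresentedGroup.mk_eq_one_iff).2 (Subgroup.subset_normalClosure (Or.inr rfl))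
  rw [commS, mul_assoc, ← mul_inv_rev, inv_mul_eq_one] at h
  exact h.symm

/-- The coordinate map on the presented Heisenberg group. -/
def toHeisCoord : Heisenberg →* HeisCoord :=
  PresentedGroup.toGroup (f := ![HeisCoord.x, HeisCoord.y]) (by
    rintro r (rfl | rfl) <;> ext <;> simp [commS])

theorem toHeisCoord_Hx : toHeisCoord Hx = HeisCoord.x := PresentedGroup.toGroup.of _

theorem toHeisCoord_Hy : toHeisCoord Hy = HeisCoord.y := PresentedGroup.toGroup.of _

/-- The homomorphism from the group of coordinates to the presented Heisenberg group. -/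
def ofHeisCoord : HeisCoord →* Heisenberg :=
  HeisCoord.lift Hx Hy Hlam rfl commute_Hlam_Hx commute_Hlam_Hy

theorem ofHeisCoord_x : ofHeisCoord HeisCoord.x = Hx := by simp [ofHeisCoord, HeisCoord.lift]

theorem ofHeisCoord_y : ofHeisCoord HeisCoord.y = Hy := by simp [ofHeisCoord, HeisCoord.lift]

/-- The presented Heisenberg group is the group of coordinates. -/
def heisEquiv : HeisCoord ≃* Heisenberg :=
  MonoidHom.toMulEquiv ofHeisCoord toHeisCoord
    (HeisCoord.hom_ext (by simp [ofHeisCoord_x, toHeisCoord_Hx])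
      (by simp [ofHeisCoord_y, toHeisCoord_Hy]))
    (PresentedGroup.ext fun i => by
      fin_cases i
      · change ofHeisCoord (toHeisCoord Hx) = Hx
        rw [toHeisCoord_Hx, ofHeisCoord_x]
      · change ofHeisCoord (toHeisCoord Hy) = Hy
        rw [toHeisCoord_Hy, ofHeisCoord_y])

theorem heisEquiv_x : heisEquiv HeisCoord.x = Hx := ofHeisCoord_x

theorem heisEquiv_y : heisEquiv HeisCoord.y = Hy := ofHeisCoord_y

theorem heisEquiv_z : heisEquiv HeisCoord.z = Hlam := by
  have h : HeisCoord.z = commS HeisCoord.x HeisCoord.y := by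
    rw [HeisCoord.commS_eq]
    rfl
  rw [h, Hlam, commS, commS]
  simp only [map_mul, map_inv, heisEquiv_x, heisEquiv_y]

theorem free_unitary_pair_heisenberg_not_type_I
    (k : Type*) [Field k] (hchar : ringChar k ≠ 2)
    (D : Type*) [DivisionRing D] [Algebra k D]
    (φ : MonoidAlgebra k Heisenberg →ₐ[k] D)
    (hφinj : Function.Injective φ)
    (hquot : ∀ d : D, ∃ a b : MonoidAlgebra k Heisenberg, φ b ≠ 0 ∧ d = φ a * (φ b)⁻¹)
    (gstar : Heisenberg → Heisenberg)
    (hgstar_mul : ∀ g h : Heisenberg, gstar (g * h) = gstar h * gstar g)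
    (hgstar_invol : ∀ g : Heisenberg, gstar (gstar g) = g)
    (invol : D →ₗ[k] D)
    (hinvol_mul : ∀ c d : D, invol (c * d) = invol d * invol c)
    (hinvol_invol : ∀ c : D, invol (invol c) = c)
    (hinduced : ∀ g : Heisenberg,
      invol (φ (MonoidAlgebra.of k Heisenberg g)) = φ (MonoidAlgebra.of k Heisenberg (gstar g)))
    (hnotI : ¬ ∃ m n : ℤ, gstar Hx = Hlam ^ m * Hx ∧ gstar Hy = Hlam ^ n * Hy) :
    ∃ u v : Dˣ, IsFreePair u v ∧ (u : D) * invol (u : D) = 1 ∧ (v : D) * invol (v : D) = 1 := by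
  have hsurj : Function.Surjective
      (MonoidAlgebra.mapDomainAlgHom k k (heisEquiv : HeisCoord →* Heisenberg)) := fun f => by
    induction f using MonoidAlgebra.induction_on with
    | of g => exact ⟨.of k _ (heisEquiv.symm g), by simp⟩
    | add x y hx hy =>
      obtain ⟨x', rfl⟩ := hx
      obtain ⟨y', rfl⟩ := hy
      exact ⟨x' + y', map_add _ _ _⟩
    | smul r x hx =>
      obtain ⟨x', rfl⟩ := hx
      exact ⟨r • x', map_smul _ _ _⟩
  refine HeisCoord.exists_free_unitary_of_quotients hchar
    (φ.comp (MonoidAlgebra.mapDomainAlgHom k k (heisEquiv : HeisCoord →* Heisenberg)))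
    (hφinj.comp (MonoidAlgebra.mapDomain_injective heisEquiv.injective)) (fun d => ?_)
    (fun g => heisEquiv.symm (gstar (heisEquiv g))) (fun g h => ?_) (fun g => ?_) invol
    hinvol_mul hinvol_invol (fun g => ?_) ?_
  · obtain ⟨a, b, hb, e⟩ := hquot d
    obtain ⟨a', rfl⟩ := hsurj a
    obtain ⟨b', rfl⟩ := hsurj b
    exact ⟨a', b', hb, e⟩
  · rw [map_mul, hgstar_mul, map_mul]
  · rw [MulEquiv.apply_symm_apply, hgstar_invol, MulEquiv.symm_apply_apply]
  · have h (g : HeisCoord) :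
        φ.comp (MonoidAlgebra.mapDomainAlgHom k k (heisEquiv : HeisCoord →* Heisenberg))
          (.of k _ g) = φ (.of k _ (heisEquiv g)) := by simp
    rw [h, h, hinduced, MulEquiv.apply_symm_apply]
  · rintro ⟨m, n, hm, hn⟩
    refine hnotI ⟨m, n, ?_, ?_⟩
    · rwa [MulEquiv.symm_apply_eq, map_mul, map_zpow, heisEquiv_x, heisEquiv_z] at hm
    · rwa [MulEquiv.symm_apply_eq, map_mul, map_zpow, heisEquiv_y, heisEquiv_z] at hn
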